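/- For every k ≥ 2 and u ∈ ℂ, one has e_k(u) = trace(B⁻_k * T_1(u) * T_2(u−1) * ⋯ * T_k(u−k+1)), where B⁻_k := (1/k!) • (1 − (k−1) • P_{k−1,k}) * (1 − (k−2) • P_{k−2,k−1}) * ⋯ * (1 − 1 • P_{1,2}) in the k-leg model. -/

import Mathlib

/-- Matrices in the `k`-leg model over `A`: square matrices indexed by functions
`Fin k → Fin n`, a model of `End((ℂ^n)^⊗k) ⊗ A`. -/
abbrev LegMatrix (n k : ℕ) (A : Type*) := Matrix (Fin k → Fin n) (Fin k → Fin n) A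

variable {n : ℕ} {A : Type*} [Ring A] [Algebra ℂ A]

/-- `T_s(v)`: the generating matrix `T(v)` placed on leg `s` of the `k`-leg model. -/
def Tleg (T : ℂ → Matrix (Fin n) (Fin n) A) {k : ℕ} (s : Fin k) (v : ℂ) :
    LegMatrix n k A := fun f g =>
  if ∀ t : Fin k, t ≠ s → f t = g t then T v (f s) (g s) else 0

/-- The permutation matrix `P_σ` of a permutation `σ` of the legs:
its `(f,g)`-entry is `1` (via `algebraMap ℂ A`) if `f = g ∘ σ` and `0` otherwise. -/
def Pleg (n : ℕ) (A : Type*) [Ring A] [Algebra ℂ A] {k : ℕ} (σ : Equiv.Perm (Fin k)) :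
    LegMatrix n k A := fun f g => if f = g ∘ σ then algebraMap ℂ A 1 else 0

/-- The transposition of legs with 1-based labels `i`, `j` (identity if out of range;
all uses are in range). -/
def legSwap (k i j : ℕ) : Equiv.Perm (Fin k) :=
  if h : 1 ≤ i ∧ i ≤ k ∧ 1 ≤ j ∧ j ≤ k then
    Equiv.swap ⟨i - 1, by omega⟩ ⟨j - 1, by omega⟩ else 1

/-- The antisymmetrizer `A_k = (1/k!) • Σ_σ sgn(σ) • P_σ` in the `k`-leg model. -/
noncomputable def Aleg (n : ℕ) (A : Type*) [Ring A] [Algebra ℂ A] (k : ℕ) :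
    LegMatrix n k A :=
  ((k.factorial : ℂ))⁻¹ •
    ∑ σ : Equiv.Perm (Fin k), ((Equiv.Perm.sign σ : ℤ) : ℂ) • Pleg n A σ

/-- The symmetrizer `S_k = (1/k!) • Σ_σ P_σ` in the `k`-leg model. -/
noncomputable def Sleg (n : ℕ) (A : Type*) [Ring A] [Algebra ℂ A] (k : ℕ) :
    LegMatrix n k A :=
  ((k.factorial : ℂ))⁻¹ • ∑ σ : Equiv.Perm (Fin k), Pleg n A σ

/-- The ordered product `T_1(u) * T_2(u+d) * ⋯ * T_k(u+(k−1)d)` in the `k`-leg model. -/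
noncomputable def TT (T : ℂ → Matrix (Fin n) (Fin n) A) (k : ℕ) (u d : ℂ) :
    LegMatrix n k A :=
  ((List.finRange k).map (fun s => Tleg T s (u + d * ((s : ℕ) : ℂ)))).prod

/-- The RTT relation of the Yangian of `gl_n`:
`((u−v) • 1 − P_{1,2}) T_1(u) T_2(v) = T_2(v) T_1(u) ((u−v) • 1 − P_{1,2})`
in the 2-leg model. -/
def RTT (T : ℂ → Matrix (Fin n) (Fin n) A) : Prop :=
  ∀ u v : ℂ,
    ((u - v) • (1 : LegMatrix n 2 A) - Pleg n A (legSwap 2 1 2)) *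
        Tleg T (0 : Fin 2) u * Tleg T (1 : Fin 2) v =
      Tleg T (1 : Fin 2) v * Tleg T (0 : Fin 2) u *
        ((u - v) • (1 : LegMatrix n 2 A) - Pleg n A (legSwap 2 1 2))

/-- The elementary symmetric function
`e_k(u) = trace(A_k * T_1(u) * T_2(u−1) * ⋯ * T_k(u−k+1))`; for `k = 0` this is `1`. -/
noncomputable def esym (T : ℂ → Matrix (Fin n) (Fin n) A) (k : ℕ) (u : ℂ) : A :=
  Matrix.trace (Aleg n A k * TT T k u (-1))

/-- The homogeneous symmetric function
`h_k(u) = trace(S_k * T_1(u) * T_2(u+1) * ⋯ * T_k(u+k−1))`; for `k = 0` this is `1`. -/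
noncomputable def hsym (T : ℂ → Matrix (Fin n) (Fin n) A) (k : ℕ) (u : ℂ) : A :=
  Matrix.trace (Sleg n A k * TT T k u 1)

/-- The power sum `p⁻_k(u) = trace(T(u) * T(u−1) * ⋯ * T(u−k+1))`,
an ordinary product of `n×n` matrices over `A`. -/
noncomputable def pminus (T : ℂ → Matrix (Fin n) (Fin n) A) (k : ℕ) (u : ℂ) : A :=
  Matrix.trace (((List.finRange k).map (fun i => T (u - ((i : ℕ) : ℂ)))).prod)

/-- The power sum `p⁺_k(u) = trace(T(u) * T(u+1) * ⋯ * T(u+k−1))`,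
an ordinary product of `n×n` matrices over `A`. -/
noncomputable def pplus (T : ℂ → Matrix (Fin n) (Fin n) A) (k : ℕ) (u : ℂ) : A :=
  Matrix.trace (((List.finRange k).map (fun i => T (u + ((i : ℕ) : ℂ)))).prod)

/-- The subgroup of permutations of the legs moving only the first `j` legs. -/
def firstLegs (k j : ℕ) : Subgroup (Equiv.Perm (Fin k)) where
  carrier := {σ | ∀ s : Fin k, j ≤ (s : ℕ) → σ s = s}
  one_mem' _ _ := rfl
  mul_mem' hσ hτ s hs := by rw [Equiv.Perm.mul_apply, hτ s hs, hσ s hs]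
  inv_mem' hσ s hs := by rw [Equiv.Perm.inv_eq_iff_eq, hσ s hs]

theorem firstLegs_mono {k i j : ℕ} (hij : i ≤ j) : firstLegs k i ≤ firstLegs k j :=
  fun _ hσ s hs => hσ s (hij.trans hs)

theorem swap_mem_firstLegs {k j : ℕ} {a b : Fin k} (ha : (a : ℕ) < j) (hb : (b : ℕ) < j) :
    Equiv.swap a b ∈ firstLegs k j := by
  intro s hs
  apply Equiv.swap_apply_of_ne_of_ne <;> rintro rfl <;> omega

theorem apply_le_of_mem_firstLegs_succ {k j : ℕ} {σ : Equiv.Perm (Fin k)}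
    (hσ : σ ∈ firstLegs k (j + 1)) (hj : j < k) : (σ ⟨j, hj⟩ : ℕ) ≤ j := by
  by_contra h
  have h1 := σ.injective (hσ (σ ⟨j, hj⟩) (by omega))
  rw [h1] at h
  simp at h

theorem swap_mul_mem_firstLegs {k j : ℕ} {σ : Equiv.Perm (Fin k)}
    (hσ : σ ∈ firstLegs k (j + 1)) (hj : j < k) :
    Equiv.swap (σ ⟨j, hj⟩) ⟨j, hj⟩ * σ ∈ firstLegs k j := by
  intro s hs
  rw [Equiv.Perm.mul_apply]
  rcases hs.eq_or_lt with h | h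
  · obtain rfl : s = ⟨j, hj⟩ := Fin.ext h.symm
    exact Equiv.swap_apply_left _ _
  · have hle := apply_le_of_mem_firstLegs_succ hσ hj
    rw [hσ s h]
    apply Equiv.swap_apply_of_ne_of_ne <;> intro h' <;> simp [Fin.ext_iff] at h' <;> omega

theorem swap_conj_adjacent {k i : ℕ} {a : Fin k} (ha : (a : ℕ) < i + 1) {hi : i < k}
    {hi' : i + 1 < k} :
    Equiv.swap a ⟨i, hi⟩ * Equiv.swap ⟨i, hi⟩ ⟨i + 1, hi'⟩ * Equiv.swap a ⟨i, hi⟩ =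
      Equiv.swap a ⟨i + 1, hi'⟩ := by
  rw [Equiv.swap_comm a ⟨i, hi⟩, Equiv.swap_comm (⟨i, hi⟩ : Fin k) ⟨i + 1, hi'⟩,
    Equiv.swap_mul_swap_mul_swap]
  · simp
  · rintro rfl
    simp at ha

/-- A submonoid containing the adjacent transpositions of the first `m` legs contains every
permutation of the first `m` legs. -/
theorem firstLegs_le_of_adjacent_swap_mem {k : ℕ} (K : Submonoid (Equiv.Perm (Fin k))) (m : ℕ)
    (hm : m ≤ k)
    (hK : ∀ i (hi : i + 1 < m), Equiv.swap ⟨i, by omega⟩ (⟨i + 1, by omega⟩ : Fin k) ∈ K) :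
    (firstLegs k m).toSubmonoid ≤ K := by
  induction m with
  | zero =>
    intro σ hσ
    obtain rfl : σ = 1 := Equiv.ext fun s => hσ s (Nat.zero_le _)
    exact K.one_mem
  | succ j ih =>
    have ih := ih (by omega) fun i hi => hK i (by omega)
    have hswap : ∀ a : Fin k, (a : ℕ) ≤ j → Equiv.swap a ⟨j, hm⟩ ∈ K := by
      intro a ha
      rcases ha.eq_or_lt with h | h
      · obtain rfl : a = ⟨j, hm⟩ := Fin.ext h
        rw [Equiv.swap_self]
        exact K.one_mem
      · obtain ⟨i, rfl⟩ : ∃ i, j = i + 1 := ⟨j - 1, by omega⟩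
        have hτ : Equiv.swap a ⟨i, by omega⟩ ∈ K :=
          ih (swap_mem_firstLegs h (Nat.lt_succ_self i))
        have hs := K.mul_mem (K.mul_mem hτ (hK i (by omega))) hτ
        rwa [swap_conj_adjacent h] at hs
    intro σ hσ
    have h1 := K.mul_mem (hswap _ (apply_le_of_mem_firstLegs_succ hσ hm))
      (ih (swap_mul_mem_firstLegs hσ hm))
    rwa [Equiv.swap_mul_self_mul] at h1

section PermutationMatrices

variable {k : ℕ}

theorem Pleg_mul_apply (σ : Equiv.Perm (Fin k)) (M : LegMatrix n k A) (f g : Fin k → Fin n) :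
    (Pleg n A σ * M) f g = M (f ∘ σ.symm) g := by
  rw [Matrix.mul_apply, Finset.sum_eq_single (f ∘ σ.symm)]
  · simp [Pleg, Function.comp_assoc]
  · intro h _ hne
    have : f ≠ h ∘ σ := by
      rintro rfl
      simp [Function.comp_assoc] at hne
    simp [Pleg, this]
  · simp

theorem mul_Pleg_apply (σ : Equiv.Perm (Fin k)) (M : LegMatrix n k A) (f g : Fin k → Fin n) :
    (M * Pleg n A σ) f g = M f (g ∘ σ) := by
  rw [Matrix.mul_apply, Finset.sum_eq_single (g ∘ σ)]
  · simp [Pleg]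
  · intro h _ hne
    simp [Pleg, hne]
  · simp

theorem Pleg_one : Pleg n A (1 : Equiv.Perm (Fin k)) = 1 := by
  ext f g
  simp [Pleg, Matrix.one_apply]

theorem Pleg_mul_Pleg (σ τ : Equiv.Perm (Fin k)) :
    Pleg n A σ * Pleg n A τ = Pleg n A (τ * σ) := by
  ext f g
  rw [mul_Pleg_apply]
  rfl

theorem trace_Pleg_mul (σ : Equiv.Perm (Fin k)) (M : LegMatrix n k A) :
    (Pleg n A σ * M).trace = (M * Pleg n A σ).trace := by
  simp only [Matrix.trace, Matrix.diag_apply, Pleg_mul_apply, mul_Pleg_apply]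
  refine Fintype.sum_equiv (Equiv.arrowCongr σ (Equiv.refl (Fin n))) _ _ fun f => ?_
  have : (f ∘ σ.symm) ∘ σ = f := by simp [Function.comp_assoc]
  simp [Equiv.arrowCongr, this]

theorem Pleg_commute_Tleg (T : ℂ → Matrix (Fin n) (Fin n) A) {σ : Equiv.Perm (Fin k)} {s : Fin k}
    (hs : σ s = s) (v : ℂ) : Commute (Pleg n A σ) (Tleg T s v) := by
  have hs' : σ.symm s = s := by rw [Equiv.symm_apply_eq, hs]
  ext f g
  rw [Pleg_mul_apply, mul_Pleg_apply]
  simp only [Tleg, Function.comp_apply, hs, hs']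
  congr 1
  rw [eq_iff_iff]
  constructor
  · intro h t ht
    simpa using h (σ t) fun h' => ht (σ.injective (h'.trans hs.symm))
  · intro h t ht
    simpa using h (σ.symm t) fun h' => ht (σ.symm.injective (h'.trans hs'.symm))

theorem Tleg_mul_Tleg_apply {B : Type*} [Ring B] (T : ℂ → Matrix (Fin n) (Fin n) B)
    {s t : Fin k} (hst : s ≠ t) (u v : ℂ) (f g : Fin k → Fin n) :
    (Tleg T s u * Tleg T t v) f g =
      if ∀ r, r ≠ s → r ≠ t → f r = g r then T u (f s) (g s) * T v (f t) (g t) else 0 := by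
  rw [Matrix.mul_apply, Finset.sum_eq_single (Function.update f s (g s))]
  · have h1 : ∀ r, r ≠ s → f r = Function.update f s (g s) r := by
      intro r hr
      simp [hr]
    have h2 : (∀ r, r ≠ t → Function.update f s (g s) r = g r) ↔
        ∀ r, r ≠ s → r ≠ t → f r = g r := by
      constructor
      · intro h r hrs hrt
        simpa [hrs] using h r hrt
      · intro h r hrt
        by_cases hrs : r = s
        · simp [hrs]
        · simpa [hrs] using h r hrs hrt
    simp only [Tleg, if_pos h1, h2]
    simp [hst.symm]
  · intro h _ hne
    by_cases h1 : ∀ r, r ≠ s → f r = h r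
    · have h2 : ¬ ∀ r, r ≠ t → h r = g r := by
        intro h2
        apply hne
        ext1 r
        by_cases hrs : r = s
        · subst hrs
          simp [h2 r hst]
        · simp [hrs, h1 r hrs]
      simp [Tleg, h2]
    · simp [Tleg, h1]
  · simp

end PermutationMatrices

/-- The RTT relation at spectral parameters differing by one, on two arbitrary legs. -/
theorem RTT.legs {T : ℂ → Matrix (Fin n) (Fin n) A} (hT : RTT T) {k : ℕ} {s t : Fin k}
    (hst : s ≠ t) (u : ℂ) :
    (1 - Pleg n A (Equiv.swap s t)) * (Tleg T s u * Tleg T t (u - 1)) =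
      Tleg T t (u - 1) * Tleg T s u * (1 - Pleg n A (Equiv.swap s t)) := by
  ext f g
  have h := congrFun (congrFun (hT u (u - 1)) ![f s, f t]) ![g s, g t]
  have h12 : legSwap 2 1 2 = Equiv.swap 0 1 := by simp [legSwap]
  have h01 : (0 : Fin 2) ≠ 1 := by decide
  have hoff : ∀ f g : Fin 2 → Fin n, ∀ r, r ≠ 0 → r ≠ 1 → f r = g r := by
    intro f g r h0 h1
    fin_cases r <;> simp_all
  have hoff' : ∀ f g : Fin 2 → Fin n, ∀ r, r ≠ 1 → r ≠ 0 → f r = g r :=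
    fun f g r h1 h0 => hoff f g r h0 h1
  rw [mul_assoc, h12] at h
  simp only [sub_mul, mul_sub, one_mul, mul_one, Matrix.sub_apply, Pleg_mul_apply,
    mul_Pleg_apply, Equiv.symm_swap, Tleg_mul_Tleg_apply T h01, Tleg_mul_Tleg_apply T h01.symm,
    if_pos (hoff _ _),
    if_pos (hoff' _ _), Function.comp_apply, Equiv.swap_apply_left, Equiv.swap_apply_right,
    sub_sub_cancel, one_smul, Matrix.cons_val_zero, Matrix.cons_val_one] at h
  simp only [sub_mul, mul_sub, one_mul, mul_one, Matrix.sub_apply, Pleg_mul_apply,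
    mul_Pleg_apply, Equiv.symm_swap, Tleg_mul_Tleg_apply T hst, Tleg_mul_Tleg_apply T hst.symm,
    Function.comp_apply, Equiv.swap_apply_left, Equiv.swap_apply_right]
  have e1 : (∀ r, r ≠ s → r ≠ t → f (Equiv.swap s t r) = g r) ↔
      ∀ r, r ≠ s → r ≠ t → f r = g r :=
    forall₃_congr fun r hs ht => by rw [Equiv.swap_apply_of_ne_of_ne hs ht]
  have e2 : (∀ r, r ≠ t → r ≠ s → f r = g (Equiv.swap s t r)) ↔
      ∀ r, r ≠ s → r ≠ t → f r = g r :=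
    ⟨fun H r hs ht => by rw [H r ht hs, Equiv.swap_apply_of_ne_of_ne hs ht],
      fun H r ht hs => by rw [H r hs ht, Equiv.swap_apply_of_ne_of_ne hs ht]⟩
  have e3 : (∀ r, r ≠ t → r ≠ s → f r = g r) ↔ ∀ r, r ≠ s → r ≠ t → f r = g r :=
    forall_congr' fun r => forall_comm
  simp only [e1, e2, e3]
  split_ifs
  · exact h
  · rfl

section Antisymmetrizer

variable {k : ℕ}

open Classical in
/-- The unnormalised antisymmetrizer over the first `j` of the `k` legs. -/
noncomputable def antisymmetrizer (n : ℕ) (A : Type*) [Ring A] [Algebra ℂ A] (k j : ℕ) :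
    LegMatrix n k A :=
  ∑ σ : Equiv.Perm (Fin k) with σ ∈ firstLegs k j,
    ((Equiv.Perm.sign σ : ℤ) : ℂ) • Pleg n A σ

theorem sign_smul_sign_smul {M : Type*} [AddCommGroup M] [Module ℂ M]
    (σ : Equiv.Perm (Fin k)) (x : M) :
    ((Equiv.Perm.sign σ : ℤ) : ℂ) • ((Equiv.Perm.sign σ : ℤ) : ℂ) • x = x := by
  rw [smul_smul, ← Int.cast_mul, ← Units.val_mul, Int.units_mul_self]
  simp

theorem antisymmetrizer_mul_Pleg {j : ℕ} {τ : Equiv.Perm (Fin k)} (hτ : τ ∈ firstLegs k j) :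
    antisymmetrizer n A k j * Pleg n A τ =
      ((Equiv.Perm.sign τ : ℤ) : ℂ) • antisymmetrizer n A k j := by
  classical
  rw [antisymmetrizer, Finset.sum_mul, Finset.smul_sum]
  refine Finset.sum_equiv (Equiv.mulLeft τ) (fun σ => ?_) fun σ _ => ?_
  · simp [Subgroup.mul_mem_cancel_left _ hτ]
  · rw [smul_mul_assoc, Pleg_mul_Pleg, Equiv.coe_mulLeft, Equiv.Perm.sign_mul, Units.val_mul,
      Int.cast_mul, mul_smul, sign_smul_sign_smul]

theorem Pleg_mul_antisymmetrizer {j : ℕ} {τ : Equiv.Perm (Fin k)} (hτ : τ ∈ firstLegs k j) :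
    Pleg n A τ * antisymmetrizer n A k j =
      ((Equiv.Perm.sign τ : ℤ) : ℂ) • antisymmetrizer n A k j := by
  classical
  rw [antisymmetrizer, Finset.mul_sum, Finset.smul_sum]
  refine Finset.sum_equiv (Equiv.mulRight τ) (fun σ => ?_) fun σ _ => ?_
  · simp [Subgroup.mul_mem_cancel_right _ hτ]
  · rw [mul_smul_comm, Pleg_mul_Pleg, Equiv.coe_mulRight, Equiv.Perm.sign_mul, mul_comm,
      Units.val_mul, Int.cast_mul, mul_smul, sign_smul_sign_smul]

/-- The number of permutations of the first `j` legs, as a complex number. -/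
noncomputable def firstLegsCard (k j : ℕ) : ℂ := Nat.card (firstLegs k j)

theorem firstLegsCard_ne_zero (j : ℕ) : firstLegsCard k j ≠ 0 :=
  Nat.cast_ne_zero.2 Nat.card_pos.ne'

theorem mul_antisymmetrizer {j : ℕ} {X : LegMatrix n k A}
    (hX : ∀ σ ∈ firstLegs k j, X * Pleg n A σ = ((Equiv.Perm.sign σ : ℤ) : ℂ) • X) :
    X * antisymmetrizer n A k j = firstLegsCard k j • X := by
  classical
  rw [antisymmetrizer, Finset.mul_sum, Finset.sum_congr rfl (g := fun _ => X)]
  · rw [Finset.sum_const, firstLegsCard, Nat.card_eq_fintype_card, Fintype.card_subtype,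
      Nat.cast_smul_eq_nsmul]
  · intro σ hσ
    rw [mul_smul_comm, hX σ (Finset.mem_filter.1 hσ).2, sign_smul_sign_smul]

theorem antisymmetrizer_succ_eq_sum {j : ℕ} (hj : j < k) :
    antisymmetrizer n A k (j + 1) =
      ∑ i ∈ Finset.Iic (⟨j, hj⟩ : Fin k), ((Equiv.Perm.sign (Equiv.swap i ⟨j, hj⟩) : ℤ) : ℂ) •
        (antisymmetrizer n A k j * Pleg n A (Equiv.swap i ⟨j, hj⟩)) := by
  classical
  rw [antisymmetrizer, ← Finset.sum_fiberwise_of_maps_to (t := Finset.Iic (⟨j, hj⟩ : Fin k))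
    (g := fun σ => σ ⟨j, hj⟩)]
  · refine Finset.sum_congr rfl fun i hi => ?_
    rw [antisymmetrizer, Finset.sum_mul, Finset.smul_sum]
    refine Finset.sum_equiv (Equiv.mulLeft (Equiv.swap i ⟨j, hj⟩)) (fun σ => ?_) fun σ _ => ?_
    · simp only [Finset.mem_filter, Finset.mem_univ, true_and, Equiv.coe_mulLeft]
      constructor
      · rintro ⟨hσ, rfl⟩
        exact swap_mul_mem_firstLegs hσ hj
      · intro hσ
        have hs : Equiv.swap i ⟨j, hj⟩ ∈ firstLegs k (j + 1) :=
          swap_mem_firstLegs (Nat.lt_succ_of_le (Fin.le_def.1 (Finset.mem_Iic.1 hi)))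
            (Nat.lt_succ_self j)
        refine ⟨(Subgroup.mul_mem_cancel_left _ hs).1 (firstLegs_mono j.le_succ hσ), ?_⟩
        have := hσ ⟨j, hj⟩ le_rfl
        rwa [Equiv.Perm.mul_apply, Equiv.swap_apply_eq_iff, Equiv.swap_apply_right] at this
    · rw [smul_mul_assoc, Pleg_mul_Pleg, Equiv.coe_mulLeft, Equiv.swap_mul_self_mul,
        Equiv.Perm.sign_mul, Units.val_mul, Int.cast_mul, mul_smul, sign_smul_sign_smul]
  · intro σ hσ
    exact Finset.mem_Iic.2 (apply_le_of_mem_firstLegs_succ (Finset.mem_filter.1 hσ).2 hj)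

/-- The fusion recursion for the antisymmetrizers. -/
theorem antisymmetrizer_succ_succ {i : ℕ} (hi : i + 1 < k) :
    firstLegsCard k (i + 1) • antisymmetrizer n A k (i + 2) =
      antisymmetrizer n A k (i + 1) *
        (1 - ((i + 1 : ℕ) : ℂ) • Pleg n A (Equiv.swap ⟨i, by omega⟩ ⟨i + 1, hi⟩)) *
          antisymmetrizer n A k (i + 1) := by
  rw [← mul_antisymmetrizer fun σ hσ =>
      antisymmetrizer_mul_Pleg (firstLegs_mono (Nat.le_succ (i + 1)) hσ),
    antisymmetrizer_succ_eq_sum hi, ← Finset.Iio_insert, Finset.sum_insert (by simp)]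
  rw [add_mul, Finset.sum_mul, Finset.sum_congr rfl (g := fun _ =>
    -(antisymmetrizer n A k (i + 1) * Pleg n A (Equiv.swap ⟨i, by omega⟩ ⟨i + 1, hi⟩) *
      antisymmetrizer n A k (i + 1)))]
  · rw [Finset.sum_const, Fin.card_Iio, Equiv.swap_self, ← Equiv.Perm.one_def, Pleg_one,
      Equiv.Perm.sign_one, mul_sub, sub_mul, smul_neg, ← sub_eq_add_neg, mul_smul_comm,
      smul_mul_assoc, Nat.cast_smul_eq_nsmul]
    simp [mul_assoc]
  · intro x hx
    have hx : (x : ℕ) < i + 1 := Fin.lt_def.1 (Finset.mem_Iio.1 hx)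
    have hτ : Equiv.swap x ⟨i, by omega⟩ ∈ firstLegs k (i + 1) :=
      swap_mem_firstLegs hx (Nat.lt_succ_self i)
    have hne : x ≠ ⟨i + 1, hi⟩ := by
      rintro rfl
      simp at hx
    rw [Equiv.Perm.sign_swap hne, Units.val_neg, Units.val_one, Int.cast_neg, Int.cast_one,
      neg_smul, one_smul, neg_mul, ← swap_conj_adjacent hx (hi := by omega), ← Pleg_mul_Pleg,
      ← Pleg_mul_Pleg, ← mul_assoc, ← mul_assoc, antisymmetrizer_mul_Pleg hτ,
      mul_assoc _ (Pleg n A (Equiv.swap x _)), Pleg_mul_antisymmetrizer hτ, mul_smul_comm,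
      smul_mul_assoc, smul_mul_assoc, sign_smul_sign_smul]

theorem antisymmetrizer_one : antisymmetrizer n A k 1 = 1 := by
  classical
  have h : ∀ σ : Equiv.Perm (Fin k), σ ∈ firstLegs k 1 ↔ σ = 1 := by
    refine fun σ => ⟨fun hσ => Equiv.ext fun s => ?_, fun h => h ▸ Subgroup.one_mem _⟩
    rcases Nat.eq_zero_or_pos (s : ℕ) with hs | hs
    · obtain ⟨s, hsk⟩ := s
      obtain rfl : s = 0 := hs
      exact Fin.ext (Nat.le_zero.1 (apply_le_of_mem_firstLegs_succ hσ hsk))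
    · exact hσ s hs
  simp [antisymmetrizer, h, Finset.filter_eq', Pleg_one]

theorem antisymmetrizer_self :
    antisymmetrizer n A k k =
      ∑ σ : Equiv.Perm (Fin k), ((Equiv.Perm.sign σ : ℤ) : ℂ) • Pleg n A σ := by
  classical
  rw [antisymmetrizer, Finset.filter_true_of_mem]
  exact fun σ _ s hs => absurd s.isLt (not_lt.2 hs)

theorem trace_antisymmetrizer_mul (j : ℕ) (M : LegMatrix n k A) :
    (antisymmetrizer n A k j * M).trace = (M * antisymmetrizer n A k j).trace := by
  simp only [antisymmetrizer, Finset.sum_mul, Finset.mul_sum, Matrix.trace_sum, smul_mul_assoc,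
    mul_smul_comm, Matrix.trace_smul, trace_Pleg_mul]

theorem Commute.antisymmetrizer_right {j : ℕ} {G : LegMatrix n k A}
    (hG : ∀ σ ∈ firstLegs k j, Commute G (Pleg n A σ)) : Commute G (antisymmetrizer n A k j) := by
  classical
  exact Commute.sum_right _ _ _ fun σ hσ => (hG σ (Finset.mem_filter.1 hσ).2).smul_right _

theorem Commute.Pleg_Tleg_list_prod (T : ℂ → Matrix (Fin n) (Fin n) A) (v : Fin k → ℂ)
    {σ : Equiv.Perm (Fin k)} {l : List (Fin k)} (hl : ∀ s ∈ l, σ s = s) :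
    Commute (Pleg n A σ) (l.map fun s => Tleg T s (v s)).prod := by
  refine Commute.list_prod_right _ _ fun M hM => ?_
  obtain ⟨s, hs, rfl⟩ := List.mem_map.1 hM
  exact Pleg_commute_Tleg T (hl s hs) _

/-- Two consecutive factors of the ordered product, surrounded by factors which commute with
the transposition of the two legs. -/
theorem exists_TT_eq_mul (T : ℂ → Matrix (Fin n) (Fin n) A) (u : ℂ) {i : ℕ} (hi : i + 1 < k) :
    ∃ L R : LegMatrix n k A,
      Commute (Pleg n A (Equiv.swap ⟨i, by omega⟩ ⟨i + 1, hi⟩)) L ∧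
      Commute (Pleg n A (Equiv.swap ⟨i, by omega⟩ ⟨i + 1, hi⟩)) R ∧
      TT T k u (-1) = L *
        (Tleg T ⟨i, by omega⟩ (u - i) * Tleg T ⟨i + 1, hi⟩ (u - i - 1)) * R := by
  have hsplit : List.finRange k = (List.finRange k).take i ++
      ([⟨i, by omega⟩, ⟨i + 1, hi⟩] ++ (List.finRange k).drop (i + 2)) := by
    conv_lhs => rw [← List.take_append_drop i (List.finRange k),
      List.drop_eq_getElem_cons (by simp; omega),
      List.drop_eq_getElem_cons (i := i + 1) (by simp; omega)]
    simp
  have hnd := List.nodup_finRange k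
  rw [hsplit, List.nodup_append, List.nodup_append] at hnd
  refine ⟨_, _,
    Commute.Pleg_Tleg_list_prod T (fun s => u + -1 * ((s : ℕ) : ℂ))
      (l := (List.finRange k).take i) fun s hs => ?_,
    Commute.Pleg_Tleg_list_prod T (fun s => u + -1 * ((s : ℕ) : ℂ))
      (l := (List.finRange k).drop (i + 2)) fun s hs => ?_, ?_⟩
  · exact Equiv.swap_apply_of_ne_of_ne (hnd.2.2 s hs _ (by simp)) (hnd.2.2 s hs _ (by simp))
  · exact Equiv.swap_apply_of_ne_of_ne (hnd.2.1.2.2 _ (by simp) s hs).symm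
      (hnd.2.1.2.2 _ (by simp) s hs).symm
  · have h0 : u + -1 * (i : ℂ) = u - i := by ring
    have h1 : u + -1 * ((i + 1 : ℕ) : ℂ) = u - i - 1 := by
      push_cast
      ring
    rw [TT]
    conv_lhs => rw [hsplit]
    simp only [List.map_append, List.prod_append, List.map_cons, List.map_nil, List.prod_cons,
      List.prod_nil, mul_one, h0, h1, mul_assoc]

theorem RTT.antisymmetrizer_mul_TT_mul_swap {T : ℂ → Matrix (Fin n) (Fin n) A} (hT : RTT T)
    (u : ℂ) {j i : ℕ} (hj : j ≤ k) (hi : i + 1 < j) :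
    antisymmetrizer n A k j * TT T k u (-1) *
        Pleg n A (Equiv.swap ⟨i, by omega⟩ ⟨i + 1, by omega⟩) =
      -(antisymmetrizer n A k j * TT T k u (-1)) := by
  set s : Fin k := ⟨i, by omega⟩ with hs
  set t : Fin k := ⟨i + 1, by omega⟩ with ht
  have hst : s ≠ t := by simp [hs, ht]
  obtain ⟨L, R, hL, hR, hTT⟩ := exists_TT_eq_mul T u (i := i) (hj.trans_lt' hi)
  rw [← hs, ← ht] at hL hR hTT
  set P := Pleg n A (Equiv.swap s t) with hP
  set a := antisymmetrizer n A k j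
  have hPP : P * P = 1 := by rw [hP, Pleg_mul_Pleg, Equiv.swap_mul_self, Pleg_one]
  have haP : a * (1 - P) = (2 : ℂ) • a := by
    rw [mul_sub, mul_one, hP, antisymmetrizer_mul_Pleg
      (swap_mem_firstLegs (by simp [hs]; omega) (by simp [ht]; omega)), Equiv.Perm.sign_swap hst]
    simp [a, two_smul]
  have hR' : R * (1 + P) = (1 + P) * R := ((Commute.one_left R).add_left hR).symm
  have hL' : (1 - P) * L = L * (1 - P) := (Commute.one_left L).sub_left hL
  have hzero : (1 - P) * TT T k u (-1) * (1 + P) = 0 := by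
    rw [hTT]
    calc _ = (1 - P) * L * (Tleg T s (u - i) * Tleg T t (u - i - 1)) * (R * (1 + P)) := by
          simp only [mul_assoc]
      _ = L * ((1 - P) * (Tleg T s (u - i) * Tleg T t (u - i - 1))) * (1 + P) * R := by
          rw [hL', hR']
          simp only [mul_assoc]
      _ = L * (Tleg T t (u - i - 1) * Tleg T s (u - i)) * ((1 - P) * (1 + P)) * R := by
          rw [hP, hT.legs hst]
          simp only [mul_assoc]
      _ = 0 := by
          have : (1 - P) * (1 + P) = 0 := by
            rw [sub_mul, mul_add, mul_add, hPP]
            simp [add_comm]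
          simp [this]
  have h2 : (2 : ℂ) • (a * TT T k u (-1) * (1 + P)) = 0 := by
    rw [← smul_mul_assoc, ← smul_mul_assoc, ← haP, mul_assoc a, mul_assoc a, hzero, mul_zero]
  have h1 := (smul_eq_zero.1 h2).resolve_left two_ne_zero
  rw [mul_add, mul_one] at h1
  exact eq_neg_of_add_eq_zero_right h1

theorem RTT.antisymmetrizer_mul_TT_mul_Pleg {T : ℂ → Matrix (Fin n) (Fin n) A} (hT : RTT T)
    (u : ℂ) {j : ℕ} (hj : j ≤ k) {σ : Equiv.Perm (Fin k)} (hσ : σ ∈ firstLegs k j) :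
    antisymmetrizer n A k j * TT T k u (-1) * Pleg n A σ =
      ((Equiv.Perm.sign σ : ℤ) : ℂ) • (antisymmetrizer n A k j * TT T k u (-1)) := by
  let K : Submonoid (Equiv.Perm (Fin k)) :=
    { carrier := {σ | antisymmetrizer n A k j * TT T k u (-1) * Pleg n A σ =
        ((Equiv.Perm.sign σ : ℤ) : ℂ) • (antisymmetrizer n A k j * TT T k u (-1))}
      one_mem' := by simp [Pleg_one]
      mul_mem' := by
        intro σ τ hσ hτ
        simp only [Set.mem_ofPred_eq] at hσ hτ ⊢
        rw [← Pleg_mul_Pleg, ← mul_assoc, hτ, smul_mul_assoc, hσ, smul_smul, mul_comm,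
          Equiv.Perm.sign_mul, Units.val_mul, Int.cast_mul] }
  refine firstLegs_le_of_adjacent_swap_mem K j hj (fun i hi => ?_) hσ
  have hne : (⟨i, by omega⟩ : Fin k) ≠ ⟨i + 1, by omega⟩ := by simp
  simpa [K, Equiv.Perm.sign_swap hne] using hT.antisymmetrizer_mul_TT_mul_swap u hj hi

theorem RTT.trace_mul_antisymmetrizer_mul_TT {T : ℂ → Matrix (Fin n) (Fin n) A} (hT : RTT T)
    (u : ℂ) {i : ℕ} (hi : i + 1 < k) {G : LegMatrix n k A}
    (hG : ∀ σ ∈ firstLegs k (i + 1), Commute G (Pleg n A σ)) :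
    (G * (antisymmetrizer n A k (i + 2) * TT T k u (-1))).trace =
      (G * (1 - ((i + 1 : ℕ) : ℂ) • Pleg n A (Equiv.swap ⟨i, by omega⟩ ⟨i + 1, hi⟩)) *
        (antisymmetrizer n A k (i + 1) * TT T k u (-1))).trace := by
  refine smul_right_injective A (firstLegsCard_ne_zero (k := k) (i + 1)) ?_
  simp only
  set F := 1 - ((i + 1 : ℕ) : ℂ) • Pleg n A (Equiv.swap (⟨i, by omega⟩ : Fin k) ⟨i + 1, hi⟩)
    with hF
  set a := antisymmetrizer n A k (i + 1) with ha
  have hTa : a * TT T k u (-1) * a = firstLegsCard k (i + 1) • (a * TT T k u (-1)) :=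
    mul_antisymmetrizer fun σ hσ => hT.antisymmetrizer_mul_TT_mul_Pleg u hi.le hσ
  have hGa : G * a = a * G := Commute.antisymmetrizer_right hG
  rw [← Matrix.trace_smul, ← Matrix.trace_smul, ← mul_smul_comm, ← smul_mul_assoc,
    antisymmetrizer_succ_succ hi, ← hF, ← mul_smul_comm, ← hTa]
  calc (G * (a * F * a * TT T k u (-1))).trace
      = (a * (G * F * (a * TT T k u (-1)))).trace := by
        simp only [← mul_assoc, hGa]
    _ = _ := by rw [trace_antisymmetrizer_mul, mul_assoc (G * F)]

end Antisymmetrizer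

theorem legSwap_succ_succ {k i : ℕ} (hi : i + 1 < k) :
    legSwap k (i + 1) (i + 2) = Equiv.swap ⟨i, by omega⟩ ⟨i + 1, hi⟩ := by
  rw [legSwap, dif_pos (by omega)]
  rfl

/-- `e_k(u) = trace(B⁻_k T_1(u) ⋯ T_k(u−k+1))` where
`B⁻_k = (1/k!) • (1 − (k−1) • P_{k−1,k}) ⋯ (1 − 1 • P_{1,2})`
(the `m`-th factor, `m = 0, …, k−2`, being `1 − (k−1−m) • P_{k−1−m,k−m}`). -/
theorem esym_eq_trace_Bminus (hn : 1 ≤ n) (T : ℂ → Matrix (Fin n) (Fin n) A)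
    (hT : RTT T) (k : ℕ) (hk : 2 ≤ k) (u : ℂ) :
    esym T k u =
      Matrix.trace
        ((((k.factorial : ℂ))⁻¹ •
            ((List.range (k - 1)).map (fun m =>
              (1 : LegMatrix n k A) -
                ((k - 1 - m : ℕ) : ℂ) • Pleg n A (legSwap k (k - 1 - m) (k - m)))).prod) *
          TT T k u (-1)) := by
  have key : ∀ p ≤ k - 1, (antisymmetrizer n A k k * TT T k u (-1)).trace =
      (((List.range p).map (fun m => (1 : LegMatrix n k A) -
        ((k - 1 - m : ℕ) : ℂ) • Pleg n A (legSwap k (k - 1 - m) (k - m)))).prod *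
          (antisymmetrizer n A k (k - p) * TT T k u (-1))).trace := by
    intro p
    induction p with
    | zero => simp
    | succ p ih =>
      intro hp
      obtain ⟨i, rfl⟩ : ∃ i, k = i + 2 + p := ⟨k - 2 - p, by omega⟩
      rw [ih (by omega), List.range_succ, List.map_append, List.prod_append]
      have e1 : i + 2 + p - p = i + 2 := by omega
      have e2 : i + 2 + p - (p + 1) = i + 1 := by omega
      have e3 : i + 2 + p - 1 - p = i + 1 := by omega
      rw [e1, e2, hT.trace_mul_antisymmetrizer_mul_TT u (by omega)]
      · rw [List.map_singleton, List.prod_singleton, e1, e3, legSwap_succ_succ]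
      · intro σ hσ
        refine Commute.list_prod_left _ _ fun M hM => ?_
        obtain ⟨m, hm, rfl⟩ := List.mem_map.1 hM
        rw [List.mem_range] at hm
        refine (Commute.one_left _).sub_left (Commute.smul_left ?_ _)
        obtain ⟨q, hq⟩ : ∃ q, i + 2 + p - m = q + 2 := ⟨i + p - m, by omega⟩
        have hq' : i + 2 + p - 1 - m = q + 1 := by omega
        rw [hq, hq', legSwap_succ_succ (by omega)]
        rw [Commute, SemiconjBy, Pleg_mul_Pleg, Pleg_mul_Pleg]
        congr 1
        rw [Equiv.mul_swap_eq_swap_mul, hσ _ (by simp; omega), hσ _ (by simp; omega)]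
  rw [esym, Aleg, ← antisymmetrizer_self, smul_mul_assoc, smul_mul_assoc, Matrix.trace_smul,
    Matrix.trace_smul, key (k - 1) le_rfl, Nat.sub_sub_self (by omega), antisymmetrizer_one,
    one_mul]
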